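/- Let G be a directed graph on a finite vertex set V and let k ≥ 1. Let X be a set of at most k edges of G (the failing edges) and let Y ⊆ V × V be a set of edges disjoint from X (the inserted edges); let S ⊆ V be the set of all endpoints of edges in Y. For each v ∈ S, let 𝒢(v) be a k-FTRS of G with respect to source v, and let 𝒢^R(v) be a subgraph of G whose reversal is a k-FTRS of the reversed graph G^R with respect to source v. Let H be the graph on V whose edge set is Y together with the union over all v ∈ S of E(𝒢(v)) and E(𝒢^R(v)). Then for every v ∈ S and every w ∈ V, v and w are strongly connected in H∖X if and only if v and w are strongly connected in (G∖X) ∪ Y; that is, the SCC of v in H∖X equals the SCC of v in the updated graph G+U. -/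

import Mathlib

/-- `v` is reachable from `u` in the directed graph with edge set `E`
(via a directed path, possibly of length 0). -/
def DReach {V : Type*} (E : Set (V × V)) (u v : V) : Prop :=
  Relation.ReflTransGen (fun a b => (a, b) ∈ E) u v

/-- `u` and `v` are strongly connected in the directed graph with edge set `E`. -/
def DSConn {V : Type*} (E : Set (V × V)) (u v : V) : Prop :=
  DReach E u v ∧ DReach E v u

/-- `H` is a `k`-fault-tolerant reachability subgraph (`k`-FTRS) of the graph
with edge set `E` with respect to the source `s`. -/
def IsKFTRS {V : Type*} (k : ℕ) (E H : Set (V × V)) (s : V) : Prop :=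
  H ⊆ E ∧ ∀ F : Finset (V × V), ↑F ⊆ E → F.card ≤ k →
    ∀ v : V, DReach (E \ ↑F) s v ↔ DReach (H \ ↑F) s v

/-- The reversal of a directed graph: all edges reversed. -/
def revE {V : Type*} (E : Set (V × V)) : Set (V × V) := {e | (e.2, e.1) ∈ E}

theorem DReach.mono {V : Type*} {A B : Set (V × V)} (h : A ⊆ B) {u v : V}
    (huv : DReach A u v) : DReach B u v :=
  Relation.ReflTransGen.mono (fun _ _ hab => h hab) u v huv

theorem dReach_revE {V : Type*} {A : Set (V × V)} {u v : V} :
    DReach (revE A) u v ↔ DReach A v u :=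
  Relation.reflTransGen_swap

/-- If `H` preserves reachability in `A` from every vertex of `S`, and contains the edges `Y`,
all of whose endpoints lie in `S`, then `H` preserves reachability in `A ∪ Y` from `S`. -/
theorem DReach.of_union {V : Type*} {A Y H : Set (V × V)} {S : Set V}
    (hA : ∀ s ∈ S, ∀ w, DReach A s w → DReach H s w) (hY : Y ⊆ H)
    (hS : ∀ e ∈ Y, e.2 ∈ S) {v w : V} (hv : v ∈ S)
    (h : DReach (A ∪ Y) v w) : DReach H v w := by
  suffices ∃ s ∈ S, DReach H v s ∧ DReach A s w by
    obtain ⟨s, hs, hvs, hsw⟩ := this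
    exact hvs.trans (hA s hs w hsw)
  induction h with
  | refl => exact ⟨v, hv, .refl, .refl⟩
  | @tail b c _ hbc ih =>
    obtain ⟨s, hs, hvs, hsb⟩ := ih
    rcases hbc with hbc | hbc
    · exact ⟨s, hs, hvs, hsb.tail hbc⟩
    · exact ⟨c, hS _ hbc, (hvs.trans (hA s hs b hsb)).tail (hY hbc), .refl⟩

/-- A subgraph whose reversal is a `k`-FTRS of the reversed graph preserves reachability to the
source. -/
theorem IsKFTRS.dReach_of_revE {V : Type*} {k : ℕ} {E H : Set (V × V)} {s : V}
    (h : IsKFTRS k (revE E) (revE H) s) {X : Finset (V × V)} (hXE : ↑X ⊆ E)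
    (hX : X.card ≤ k) {v : V} (hv : DReach (E \ ↑X) v s) : DReach (H \ ↑X) v s := by
  have hF : (↑(X.map (Equiv.prodComm V V).toEmbedding) : Set (V × V)) = revE ↑X := by
    ext ⟨a, b⟩
    simp [revE]
  have key := h.2 (X.map (Equiv.prodComm V V).toEmbedding)
    (by rw [hF]; exact fun e he => hXE he) (by simpa using hX) v
  rw [hF] at key
  exact dReach_revE.1 (key.1 (dReach_revE.2 hv))

/-- Lemma 10 of the paper. Let `G` be a directed graph,
`k ≥ 1`, `X` a set of at most `k` failing edges of `G`, and `Y` a set of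
inserted edges disjoint from `X`; let `S` be the set of endpoints of edges of
`Y`.  For each `v ∈ S` let `𝒢 v` be a `k`-FTRS of `G` w.r.t. `v` and let
`𝒢R v` be a subgraph of `G` whose reversal is a `k`-FTRS of the reversed graph
`G^R` w.r.t. `v`.  Let `H` be the graph whose edges are `Y` together with the
edges of all the `𝒢 v` and `𝒢R v` for `v ∈ S`.  Then for every `v ∈ S` and
every `w`, `v` and `w` are strongly connected in `H ∖ X` iff they are strongly
connected in the updated graph `(G ∖ X) ∪ Y`. -/
theorem scc_after_updates {V : Type*} [Fintype V]
    (E : Set (V × V)) (k : ℕ) (hk : 1 ≤ k)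
    (X : Finset (V × V)) (hXE : ↑X ⊆ E) (hXcard : X.card ≤ k)
    (Y : Set (V × V)) (hXY : Disjoint Y (↑X : Set (V × V)))
    (S : Set V) (hS : S = {v | ∃ e ∈ Y, e.1 = v ∨ e.2 = v})
    (G' GR : V → Set (V × V))
    (hG' : ∀ v ∈ S, IsKFTRS k E (G' v) v)
    (hGR : ∀ v ∈ S, GR v ⊆ E ∧ IsKFTRS k (revE E) (revE (GR v)) v)
    (H : Set (V × V)) (hH : H = Y ∪ ⋃ v ∈ S, (G' v ∪ GR v)) :
    ∀ v ∈ S, ∀ w : V,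
      DSConn (H \ ↑X) v w ↔ DSConn ((E \ ↑X) ∪ Y) v w := by
  have hYH : Y ⊆ H \ ↑X := fun e he =>
    ⟨hH ▸ Or.inl he, Set.disjoint_left.1 hXY he⟩
  have hsub : ∀ s ∈ S, G' s ∪ GR s ⊆ H := fun s hs => by
    rw [hH]
    exact (Set.subset_biUnion_of_mem (u := fun v => G' v ∪ GR v) hs).trans
      Set.subset_union_right
  have hHE : H \ ↑X ⊆ (E \ ↑X) ∪ Y := by
    rintro e ⟨he, heX⟩
    rw [hH] at he
    rcases he with he | he
    · exact Or.inr he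
    · simp only [Set.mem_iUnion] at he
      obtain ⟨s, hs, he | he⟩ := he
      · exact Or.inl ⟨(hG' s hs).1 he, heX⟩
      · exact Or.inl ⟨(hGR s hs).1 he, heX⟩
  intro v hv w
  refine ⟨fun h => ⟨h.1.mono hHE, h.2.mono hHE⟩, fun h => ⟨?_, ?_⟩⟩
  · refine DReach.of_union (fun s hs u hsu => ?_) hYH
      (fun e he => hS ▸ ⟨e, he, Or.inr rfl⟩) hv h.1
    exact (((hG' s hs).2 X hXE hXcard u).1 hsu).mono
      (Set.sdiff_subset_sdiff_left (Set.subset_union_left.trans (hsub s hs)))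
  · refine dReach_revE.1 (DReach.of_union (A := revE (E \ ↑X)) (Y := revE Y)
      (H := revE (H \ ↑X))
      (fun s hs u hsu => ?_) (fun e he => hYH he)
      (fun e he => hS ▸ ⟨_, he, Or.inl rfl⟩) hv (dReach_revE.2 h.2))
    exact dReach_revE.2 (((hGR s hs).2.dReach_of_revE hXE hXcard (dReach_revE.1 hsu)).mono
      (Set.sdiff_subset_sdiff_left (Set.subset_union_right.trans (hsub s hs))))
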